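/- arXiv:2102.13050 — 3 statements merged into one kernel-verified Lean document; each statement's English description precedes it below -/
import Mathlib

section
/- Let d ≥ 2 be an integer and let I be any subset of the positive integers. Define A = { Σ_{i=1}^∞ a_i d^{-i} : a_i ∈ {0,1,…,d−1}, a_i = 0 for i ∉ I } and B = { Σ_{i=1}^∞ b_i d^{-i} : b_i ∈ {0,1,…,d−1}, b_i = 0 for i ∈ I }. Then the Hausdorff dimension of the Cartesian product A × B ⊆ ℝ² is at least 1. -/
open Set MeasureTheory

/-- The set of reals `Σ_{i=1}^∞ aᵢ d^{-i}` with digits `aᵢ ∈ {0,…,d−1}` vanishing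
at every position outside `I`. -/
def digitSet (d : ℕ) (I : Set ℕ+) : Set ℝ :=
  {x | ∃ a : ℕ+ → ℕ, (∀ i, a i < d) ∧ (∀ i, i ∉ I → a i = 0) ∧
    x = ∑' i : ℕ+, (a i : ℝ) / (d : ℝ) ^ (i : ℕ)}

/-- The Cartesian product `A × B` regarded as a subset of `ℝ²`. -/
def pairSet (A B : Set ℝ) : Set (EuclideanSpace ℝ (Fin 2)) :=
  {z | z 0 ∈ A ∧ z 1 ∈ B}

/-- A digit sequence gives a summable series. -/
lemma digit_summable (d : ℕ) (a : ℕ+ → ℕ) (ha : ∀ i, a i < d) :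
    Summable (fun i : ℕ+ => (a i : ℝ) / (d : ℝ) ^ (i : ℕ)) := by
  have h := Real.summable_ofDigitsTerm (b := d)
    (digits := fun n => ⟨a n.succPNat, ha _⟩)
  rw [← Equiv.pnatEquivNat.symm.summable_iff]
  refine h.congr fun n => ?_
  simp [Real.ofDigitsTerm, div_eq_mul_inv]

/-- Every point of `[0,1)` is a sum of a point of `A` and a point of `B`. -/
lemma Ico_subset_sum (d : ℕ) (hd : 2 ≤ d) (I : Set ℕ+) (x : ℝ) (hx : x ∈ Set.Ico (0 : ℝ) 1) :
    ∃ u ∈ digitSet d I, ∃ v ∈ digitSet d Iᶜ, u + v = x := by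
  classical
  have : NeZero d := ⟨by omega⟩
  have hd0 : 0 < d := by omega
  set c : ℕ+ → ℕ := fun i => (Real.digits x d i.natPred : ℕ) with hc
  have hcd : ∀ i, c i < d := fun i => (Real.digits x d i.natPred).isLt
  have h1 : ∀ i, (if i ∈ I then c i else 0) < d := by
    intro i; split_ifs
    · exact hcd i
    · exact hd0
  have h2 : ∀ i, (if i ∈ I then 0 else c i) < d := by
    intro i; split_ifs
    · exact hd0
    · exact hcd i
  refine ⟨_, ⟨fun i => if i ∈ I then c i else 0, h1, fun i hi => by simp [hi], rfl⟩,
    _, ⟨fun i => if i ∈ I then 0 else c i, h2, fun i hi => ?_, rfl⟩, ?_⟩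
  · have : i ∈ I := by simpa using hi
    simp [this]
  · rw [← (digit_summable d _ h1).tsum_add (digit_summable d _ h2)]
    conv_rhs => rw [← Real.ofDigits_digits (b := d) (by omega) hx]
    rw [Real.ofDigits, ← Equiv.pnatEquivNat.symm.tsum_eq (fun i : ℕ+ => _)]
    refine tsum_congr fun n => ?_
    by_cases h : n.succPNat ∈ I <;> simp [h, hc, Real.ofDigitsTerm, div_eq_mul_inv]

/-- For `d ≥ 2` and any set `I` of positive integers, the Hausdorff dimension of
`A × B ⊆ ℝ²` is at least `1`, where `A` and `B` are the sets of reals whose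
base-`d` digits vanish outside `I`, resp. on `I`. -/
theorem one_le_dimH_digitSet_prod (d : ℕ) (hd : 2 ≤ d) (I : Set ℕ+) :
    1 ≤ dimH (pairSet (digitSet d I) (digitSet d Iᶜ)) := by
  let L : EuclideanSpace ℝ (Fin 2) →L[ℝ] ℝ :=
    EuclideanSpace.proj (0 : Fin 2) + EuclideanSpace.proj (1 : Fin 2)
  have hsub : Set.Ico (0 : ℝ) 1 ⊆ L '' pairSet (digitSet d I) (digitSet d Iᶜ) := by
    intro x hx
    obtain ⟨u, hu, v, hv, huv⟩ := Ico_subset_sum d hd I x hx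
    refine ⟨!₂[u, v], ⟨by simpa using hu, by simpa using hv⟩, ?_⟩
    simpa [L] using huv
  have h1 : dimH (Set.Ico (0 : ℝ) 1) = 1 := by
    rw [Real.dimH_of_nonempty_interior (E := ℝ) (by simp)]
    simp
  calc 1 = dimH (Set.Ico (0 : ℝ) 1) := h1.symm
    _ ≤ _ := dimH_mono hsub
    _ ≤ _ := L.lipschitz.dimH_image_le _
end

section
/- There exist subsets A and B of the interval [0,1] such that dim_H(A) = 0, dim_H(B) = 0, and dim_H(A × B) ≥ 1. In particular, the Hausdorff dimension is not product-summable: dim_H(A × B) > dim_H(A) + dim_H(B). -/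
open Set MeasureTheory

open scoped NNReal ENNReal Topology in
/-- A dense Gδ set, of Hausdorff dimension zero. -/
def thinG : Set ℝ := ⋂ n : ℕ, ⋃ k : ℕ,
  Metric.ball (TopologicalSpace.denseSeq ℝ k) ((1 / 2 : ℝ) ^ (n + k) / 2)

theorem thinG_residual : thinG ∈ residual ℝ := by
  refine countable_iInter_mem.2 fun n => ?_
  refine residual_of_dense_open (isOpen_iUnion fun k => Metric.isOpen_ball) ?_
  refine (TopologicalSpace.denseRange_denseSeq ℝ).mono ?_
  rintro _ ⟨k, rfl⟩
  exact mem_iUnion.2 ⟨k, Metric.mem_ball_self (by positivity)⟩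

open scoped NNReal ENNReal Topology in
theorem thinG_measure (d : ℝ≥0) (hd : 0 < d) : Measure.hausdorffMeasure (d : ℝ) thinG = 0 := by
  have hd' : (0 : ℝ) < d := hd
  set c : ℝ≥0∞ := (2⁻¹ : ℝ≥0∞) ^ (d : ℝ) with hc
  have hc1 : c < 1 := ENNReal.rpow_lt_one (by simp) hd'
  have hdiam : ∀ n k : ℕ, Metric.ediam (Metric.ball (TopologicalSpace.denseSeq ℝ k)
      ((1 / 2 : ℝ) ^ (n + k) / 2)) ≤ (2⁻¹ : ℝ≥0∞) ^ (n + k) := by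
    intro n k
    rw [Real.ball_eq_Ioo, Real.ediam_Ioo]
    apply le_of_eq
    rw [show (TopologicalSpace.denseSeq ℝ k + (1 / 2 : ℝ) ^ (n + k) / 2 -
      (TopologicalSpace.denseSeq ℝ k - (1 / 2 : ℝ) ^ (n + k) / 2)) = (2⁻¹ : ℝ) ^ (n + k) by
        rw [one_div]; ring]
    rw [ENNReal.ofReal_pow (by norm_num), ENNReal.ofReal_inv_of_pos (by norm_num)]
    simp
  have hh : (2⁻¹ : ℝ≥0∞) < 1 := by simp
  have key := Measure.hausdorffMeasure_le_liminf_tsum (β := ℕ) (ι := fun _ => ℕ) (d : ℝ) thinG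
    (l := Filter.atTop) (fun n => (2⁻¹ : ℝ≥0∞) ^ n)
    (ENNReal.tendsto_pow_atTop_nhds_zero_of_lt_one hh)
    (fun n k => Metric.ball (TopologicalSpace.denseSeq ℝ k) ((1 / 2 : ℝ) ^ (n + k) / 2))
    (Filter.Eventually.of_forall fun n k => (hdiam n k).trans
      (pow_le_pow_right_of_le_one' hh.le (Nat.le_add_right n k)))
    (Filter.Eventually.of_forall fun n => iInter_subset _ n)
  have hsum : ∀ n : ℕ, (∑' k : ℕ, Metric.ediam (Metric.ball (TopologicalSpace.denseSeq ℝ k)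
      ((1 / 2 : ℝ) ^ (n + k) / 2)) ^ (d : ℝ)) ≤ c ^ n * (1 - c)⁻¹ := by
    intro n
    rw [← ENNReal.tsum_geometric, ← ENNReal.tsum_mul_left]
    refine ENNReal.tsum_le_tsum fun k => ?_
    refine (ENNReal.rpow_le_rpow (hdiam n k) hd'.le).trans (le_of_eq ?_)
    rw [← pow_add, hc, ← ENNReal.rpow_natCast, ← ENNReal.rpow_natCast, ← ENNReal.rpow_mul,
      ← ENNReal.rpow_mul, mul_comm]
  have hlim : Filter.Tendsto (fun n : ℕ => c ^ n * (1 - c)⁻¹) Filter.atTop (𝓝 0) := by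
    have := ENNReal.Tendsto.mul_const (b := (1 - c)⁻¹)
      (ENNReal.tendsto_pow_atTop_nhds_zero_of_lt_one hc1)
      (Or.inr (ENNReal.inv_ne_top.2 (tsub_pos_of_lt hc1).ne'))
    simpa using this
  have hlim2 := tendsto_of_tendsto_of_tendsto_of_le_of_le tendsto_const_nhds hlim
    (fun n => zero_le) hsum
  rw [hlim2.liminf_eq] at key
  exact le_antisymm key zero_le

open scoped NNReal ENNReal in
theorem thinG_dimH : dimH thinG = 0 := by
  refine le_antisymm (ENNReal.le_of_forall_pos_le_add fun ε hε _ => ?_) zero_le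
  rw [zero_add]
  exact dimH_le_of_hausdorffMeasure_ne_top (by rw [thinG_measure ε hε]; simp)

theorem thinG_sum (t : ℝ) (ht : t ∈ Ioo (0 : ℝ) 1) :
    ∃ x ∈ thinG ∩ Icc 0 1, t - x ∈ thinG ∩ Icc 0 1 := by
  have h1 : (fun x => t - x) ⁻¹' thinG ∈ residual ℝ := by
    refine (mem_residual.2 ?_)
    obtain ⟨s, hs, hG, hD⟩ := mem_residual.1 thinG_residual
    exact ⟨(Homeomorph.subLeft t) ⁻¹' s, preimage_mono hs, hG.preimage (by fun_prop),
      hD.preimage (Homeomorph.subLeft t).isOpenMap⟩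
  have h2 := dense_of_mem_residual (Filter.inter_mem thinG_residual h1)
  obtain ⟨x, hx, hxG, hxG'⟩ := h2.inter_open_nonempty (Ioo 0 t) isOpen_Ioo ⟨t / 2, by
    constructor <;> linarith [ht.1]⟩
  refine ⟨x, ⟨hxG, hx.1.le, by linarith [hx.2, ht.2]⟩, hxG', by linarith [hx.2], ?_⟩
  linarith [hx.1, ht.2]

theorem hausdorff_dim_not_product_summable :
    ∃ A B : Set ℝ, A ⊆ Set.Icc 0 1 ∧ B ⊆ Set.Icc 0 1 ∧
      dimH A = 0 ∧ dimH B = 0 ∧ 1 ≤ dimH (pairSet A B) ∧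
      dimH A + dimH B < dimH (pairSet A B) := by
  have h0 : dimH (thinG ∩ Icc 0 1) = 0 :=
    le_antisymm ((dimH_mono inter_subset_left).trans thinG_dimH.le) zero_le
  have h1 : 1 ≤ dimH (pairSet (thinG ∩ Icc 0 1) (thinG ∩ Icc 0 1)) := by
    let f : EuclideanSpace ℝ (Fin 2) →L[ℝ] ℝ :=
      EuclideanSpace.proj (0 : Fin 2) + EuclideanSpace.proj (1 : Fin 2)
    have hsub : Ioo (0 : ℝ) 1 ⊆ f '' pairSet (thinG ∩ Icc 0 1) (thinG ∩ Icc 0 1) := by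
      intro t ht
      obtain ⟨x, hx, hy⟩ := thinG_sum t ht
      exact ⟨!₂[x, t - x], ⟨by simpa using hx, by simpa using hy⟩, by simp [f]⟩
    have hI : dimH (Ioo (0 : ℝ) 1) = 1 := by
      rw [Real.dimH_of_nonempty_interior (by simp)]
      simp
    calc (1 : ENNReal) = dimH (Ioo (0 : ℝ) 1) := hI.symm
      _ ≤ _ := dimH_mono hsub
      _ ≤ _ := f.lipschitz.dimH_image_le _
  refine ⟨_, _, inter_subset_right, inter_subset_right, h0, h0, h1, ?_⟩
  rw [h0, add_zero]
  exact lt_of_lt_of_le one_pos h1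
end

section
/- There exist nonempty subsets A and B of the interval [0,1] such that: liminf_{ε→0⁺} log N_A(ε)/log(1/ε) = 0 and limsup_{ε→0⁺} log N_A(ε)/log(1/ε) = 1; liminf_{ε→0⁺} log N_B(ε)/log(1/ε) = 0 and limsup_{ε→0⁺} log N_B(ε)/log(1/ε) = 1; and the Minkowski dimension of A × B exists with lim_{ε→0⁺} log N_{A×B}(ε)/log(1/ε) = 1. In particular, the upper Minkowski dimension is not product-summable, since dim_{M*}(A) + dim_{M*}(B) = 2 ≠ 1 = dim_{M*}(A × B), and the standard Minkowski dimension of A and of B does not exist. -/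
open Filter Metric Set

/-- The covering number of `A` by closed balls of radius `ε`. -/
noncomputable def coverNum {X : Type*} [MetricSpace X] (A : Set X) (ε : ℝ) : ℕ :=
  sInf {k | ∃ c : Fin k → X, A ⊆ ⋃ i, Metric.closedBall (c i) ε}

lemma coverNum_le_card {X : Type*} [MetricSpace X] {A : Set X} {ε : ℝ} {ι : Type*} [Fintype ι]
    (f : ι → X) (h : A ⊆ ⋃ i, Metric.closedBall (f i) ε) : coverNum A ε ≤ Fintype.card ι := by
  refine Nat.sInf_le ⟨f ∘ (Fintype.equivFin ι).symm, fun x hx => ?_⟩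
  obtain ⟨i, hi⟩ := Set.mem_iUnion.1 (h hx)
  exact Set.mem_iUnion.2 ⟨Fintype.equivFin ι i, by simpa using hi⟩

/-- Existence of a finite cover at scale `ε`. -/
def FinCov {X : Type*} [MetricSpace X] (A : Set X) (ε : ℝ) : Prop :=
  ∃ k : ℕ, ∃ c : Fin k → X, A ⊆ ⋃ i, Metric.closedBall (c i) ε

lemma finCov_of {X : Type*} [MetricSpace X] {A : Set X} {ε : ℝ} {ι : Type*} [Fintype ι]
    (f : ι → X) (h : A ⊆ ⋃ i, Metric.closedBall (f i) ε) : FinCov A ε := by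
  refine ⟨_, f ∘ (Fintype.equivFin ι).symm, fun x hx => ?_⟩
  obtain ⟨i, hi⟩ := Set.mem_iUnion.1 (h hx)
  exact Set.mem_iUnion.2 ⟨Fintype.equivFin ι i, by simpa using hi⟩

lemma FinCov.mono {X : Type*} [MetricSpace X] {A : Set X} {ε ε' : ℝ} (h : FinCov A ε)
    (hε : ε ≤ ε') : FinCov A ε' := by
  obtain ⟨k, c, hc⟩ := h
  exact ⟨k, c, hc.trans (Set.iUnion_mono fun i => Metric.closedBall_subset_closedBall hε)⟩

lemma coverNum_anti {X : Type*} [MetricSpace X] {A : Set X} {ε ε' : ℝ} (h : FinCov A ε)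
    (hε : ε ≤ ε') : coverNum A ε' ≤ coverNum A ε := by
  obtain ⟨c, hc⟩ := Nat.sInf_mem (s := {k | ∃ c : Fin k → X, A ⊆ ⋃ i, Metric.closedBall (c i) ε}) h
  exact Nat.sInf_le
    ⟨c, hc.trans (Set.iUnion_mono fun i => Metric.closedBall_subset_closedBall hε)⟩

lemma card_le_coverNum {X : Type*} [MetricSpace X] {A : Set X} {ε : ℝ} {ι : Type*} [Fintype ι]
    (f : ι → X) (hf : ∀ i, f i ∈ A) (hsep : ∀ i j, i ≠ j → 2 * ε < dist (f i) (f j))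
    (h : FinCov A ε) : Fintype.card ι ≤ coverNum A ε := by
  obtain ⟨c, hc⟩ := Nat.sInf_mem (s := {k | ∃ c : Fin k → X, A ⊆ ⋃ i, Metric.closedBall (c i) ε}) h
  have h1 : ∀ i, ∃ j, f i ∈ Metric.closedBall (c j) ε := fun i => Set.mem_iUnion.1 (hc (hf i))
  choose g hg using h1
  have hinj : Function.Injective g := by
    intro i j hij
    by_contra hne
    have h2 := hsep i j hne
    have h3 := hg i
    have h4 := hg j
    rw [← hij] at h4
    rw [Metric.mem_closedBall] at h3 h4
    have := dist_triangle_right (f i) (f j) (c (g i))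
    linarith
  simpa [coverNum] using Fintype.card_le_of_injective g hinj

/-- The value of a finite set of binary digits. -/
noncomputable def bval (T : Finset ℕ) : ℝ := ∑ i ∈ T, (1 / 2 : ℝ) ^ (i + 1)

/-- The numbers whose (finitely many) nonzero binary digits are at positions in `S`. -/
def dset (S : Set ℕ) : Set ℝ := {x | ∃ T : Finset ℕ, (∀ i ∈ T, i ∈ S) ∧ x = bval T}

lemma bval_nonneg (T : Finset ℕ) : 0 ≤ bval T := Finset.sum_nonneg fun i _ => by positivity

lemma bval_tail (n : ℕ) (T : Finset ℕ) (h : ∀ i ∈ T, n ≤ i) : bval T ≤ (1 / 2 : ℝ) ^ n := by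
  obtain ⟨M, hM⟩ : ∃ M, ∀ i ∈ T, i < M := ⟨T.sup id + 1, fun i hi =>
    Nat.lt_succ_of_le (Finset.le_sup (f := id) hi)⟩
  have h1 : bval T ≤ ∑ i ∈ Finset.Ico n (n + M), (1 / 2 : ℝ) ^ (i + 1) := by
    refine Finset.sum_le_sum_of_subset_of_nonneg ?_ fun i _ _ => by positivity
    intro i hi
    have := h i hi
    have := hM i hi
    simp; omega
  have h2 : ∀ M : ℕ, ∑ i ∈ Finset.Ico n (n + M), (1 / 2 : ℝ) ^ (i + 1)
      = (1 / 2) ^ n - (1 / 2) ^ (n + M) := by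
    intro M
    induction M with
    | zero => simp
    | succ M ih =>
      rw [← add_assoc, Finset.sum_Ico_succ_top (by omega), ih]
      ring
  have h3 : (0 : ℝ) < (1 / 2) ^ (n + M) := by positivity
  rw [h2] at h1
  linarith

lemma bval_sep (n : ℕ) (T T' : Finset ℕ) (h : ∀ i ∈ T, i < n) (h' : ∀ i ∈ T', i < n)
    (hne : T ≠ T') : (1 / 2 : ℝ) ^ n ≤ |bval T - bval T'| := by
  have key : ∀ T : Finset ℕ, (∀ i ∈ T, i < n) →
      bval T = (1 / 2 : ℝ) ^ n * ((∑ j ∈ T.image (fun i => n - 1 - i), 2 ^ j : ℕ) : ℝ) := by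
    intro T h
    rw [Finset.sum_image]
    · push_cast
      rw [Finset.mul_sum]
      refine Finset.sum_congr rfl fun i hi => ?_
      have := h i hi
      have e : n = (i + 1) + (n - 1 - i) := by omega
      conv_rhs => rw [show (1 / 2 : ℝ) ^ n = (1 / 2) ^ ((i + 1) + (n - 1 - i)) from by rw [← e]]
      rw [pow_add _ (i + 1), mul_assoc, ← mul_pow]
      norm_num
    · intro i hi j hj hij
      have := h i hi
      have := h j hj
      simp only at hij
      omega
  rw [key T h, key T' h', ← mul_sub, abs_mul, abs_of_pos (by positivity : (0 : ℝ) < (1 / 2) ^ n)]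
  have hne2 : (∑ j ∈ T.image (fun i => n - 1 - i), 2 ^ j : ℕ)
      ≠ ∑ j ∈ T'.image (fun i => n - 1 - i), 2 ^ j := by
    intro he
    have h1 := Finset.geomSum_injective (le_refl 2) he
    apply hne
    have aux : ∀ T T' : Finset ℕ, (∀ i ∈ T, i < n) → (∀ i ∈ T', i < n) →
        T.image (fun i => n - 1 - i) = T'.image (fun i => n - 1 - i) → T ⊆ T' := by
      intro T T' h h' h1 i hi
      have h2 : n - 1 - i ∈ T'.image (fun i => n - 1 - i) := by
        rw [← h1]; exact Finset.mem_image_of_mem _ hi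
      obtain ⟨j, hj, hij⟩ := Finset.mem_image.1 h2
      have := h i hi
      have := h' j hj
      have : i = j := by omega
      rwa [this]
    exact Finset.Subset.antisymm (aux T T' h h' h1) (aux T' T h' h h1.symm)
  have h2 : (1 : ℝ) ≤ |((∑ j ∈ T.image (fun i => n - 1 - i), 2 ^ j : ℕ) : ℝ)
      - ((∑ j ∈ T'.image (fun i => n - 1 - i), 2 ^ j : ℕ) : ℝ)| := by
    have h3 : ((∑ j ∈ T.image (fun i => n - 1 - i), 2 ^ j : ℕ) : ℤ)
      - ((∑ j ∈ T'.image (fun i => n - 1 - i), 2 ^ j : ℕ) : ℤ) ≠ 0 := by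
      rw [sub_ne_zero]; exact_mod_cast hne2
    have h4 := Int.one_le_abs h3
    exact_mod_cast h4
  exact le_mul_of_one_le_right (by positivity) h2

open Classical in
/-- The positions of `S` below `n`. -/
noncomputable def pos (S : Set ℕ) (n : ℕ) : Finset ℕ := (Finset.range n).filter (· ∈ S)

/-- Digit strings of length `n` supported on `S`. -/
abbrev Dig (S : Set ℕ) (n : ℕ) := {T : Finset ℕ // T ∈ (pos S n).powerset}

lemma card_dig (S : Set ℕ) (n : ℕ) : Fintype.card (Dig S n) = 2 ^ (pos S n).card := by
  rw [Fintype.card_coe, Finset.card_powerset]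

lemma dig_lt {S : Set ℕ} {n : ℕ} (T : Dig S n) : ∀ i ∈ T.1, i < n := by
  intro i hi
  have := Finset.mem_powerset.1 T.2 hi
  simp [pos] at this
  exact this.1

lemma dig_mem {S : Set ℕ} {n : ℕ} (T : Dig S n) : bval T.1 ∈ dset S := by
  refine ⟨T.1, fun i hi => ?_, rfl⟩
  have := Finset.mem_powerset.1 T.2 hi
  simp [pos] at this
  exact this.2

lemma dset_near {S : Set ℕ} (n : ℕ) {x : ℝ} (hx : x ∈ dset S) :
    ∃ T : Dig S n, |x - bval T.1| ≤ (1 / 2) ^ n := by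
  obtain ⟨T, hT, rfl⟩ := hx
  refine ⟨⟨T.filter (· < n), ?_⟩, ?_⟩
  · rw [Finset.mem_powerset]
    intro i hi
    simp at hi
    simp [pos, hi.2, hT i hi.1]
  · have h1 : bval T = bval (T.filter (· < n)) + bval (T.filter (¬ · < n)) :=
      (Finset.sum_filter_add_sum_filter_not T (· < n) _).symm
    have h2 := bval_tail n (T.filter (¬ · < n)) (by intro i hi; simp at hi; exact hi.2)
    have h3 := bval_nonneg (T.filter (¬ · < n))
    rw [h1, add_sub_cancel_left, abs_of_nonneg h3]
    exact h2

lemma dset_sub (S : Set ℕ) : dset S ⊆ Set.Icc 0 1 := by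
  rintro x ⟨T, -, rfl⟩
  exact ⟨bval_nonneg T, by simpa using bval_tail 0 T (by simp)⟩

lemma zero_mem_dset (S : Set ℕ) : (0 : ℝ) ∈ dset S := ⟨∅, by simp, by simp [bval]⟩

lemma dset_cov (S : Set ℕ) (n : ℕ) :
    dset S ⊆ ⋃ T : Dig S n, Metric.closedBall (bval T.1) ((1 / 2) ^ n) := by
  intro x hx
  obtain ⟨T, hT⟩ := dset_near n hx
  exact Set.mem_iUnion.2 ⟨T, by rwa [Metric.mem_closedBall, Real.dist_eq]⟩

lemma dset_fin (S : Set ℕ) (ε : ℝ) (h : 0 < ε) : FinCov (dset S) ε := by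
  obtain ⟨n, hn⟩ := exists_pow_lt_of_lt_one h (by norm_num : (1 / 2 : ℝ) < 1)
  exact (finCov_of _ (dset_cov S n)).mono hn.le

lemma dset_up (S : Set ℕ) (n : ℕ) : coverNum (dset S) ((1 / 2) ^ n) ≤ 2 ^ (pos S n).card := by
  rw [← card_dig]
  exact coverNum_le_card _ (dset_cov S n)

lemma two_mul_lt (n : ℕ) : 2 * (1 / 2 : ℝ) ^ (n + 2) < (1 / 2) ^ n := by
  have : (0 : ℝ) < (1 / 2) ^ n := by positivity
  rw [pow_add]; linarith

lemma dset_low (S : Set ℕ) (n : ℕ) :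
    2 ^ (pos S n).card ≤ coverNum (dset S) ((1 / 2) ^ (n + 2)) := by
  rw [← card_dig]
  refine card_le_coverNum (fun T : Dig S n => bval T.1) dig_mem ?_ (dset_fin S _ (by positivity))
  intro T T' hne
  rw [Real.dist_eq]
  exact (two_mul_lt n).trans_le
    (bval_sep n _ _ (dig_lt T) (dig_lt T') fun h => hne (Subtype.ext h))

lemma pair_cov (S S' : Set ℕ) (n : ℕ) :
    pairSet (dset S) (dset S') ⊆ ⋃ T : Dig S (n + 1) × Dig S' (n + 1),
      Metric.closedBall (!₂[bval T.1.1, bval T.2.1] : EuclideanSpace ℝ (Fin 2))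
        ((1 / 2) ^ n) := by
  rintro z ⟨h0, h1⟩
  obtain ⟨T, hT⟩ := dset_near (n + 1) h0
  obtain ⟨T', hT'⟩ := dset_near (n + 1) h1
  refine Set.mem_iUnion.2 ⟨(T, T'), ?_⟩
  rw [Metric.mem_closedBall, EuclideanSpace.dist_eq]
  refine Real.sqrt_le_iff.2 ⟨by positivity, ?_⟩
  simp only [Fin.sum_univ_two, Real.dist_eq]
  simp only [Matrix.cons_val_zero, Matrix.cons_val_one]
  have e : (1 / 2 : ℝ) ^ n = 2 * (1 / 2) ^ (n + 1) := by rw [pow_succ]; ring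
  rw [e]
  have a := abs_nonneg (z 0 - bval T.1)
  have b := abs_nonneg (z 1 - bval T'.1)
  nlinarith

lemma pair_fin (S S' : Set ℕ) (ε : ℝ) (h : 0 < ε) : FinCov (pairSet (dset S) (dset S')) ε := by
  obtain ⟨n, hn⟩ := exists_pow_lt_of_lt_one h (by norm_num : (1 / 2 : ℝ) < 1)
  exact (finCov_of _ (pair_cov S S' n)).mono hn.le

lemma pair_up (S S' : Set ℕ) (n : ℕ) : coverNum (pairSet (dset S) (dset S')) ((1 / 2) ^ n)
    ≤ 2 ^ ((pos S (n + 1)).card + (pos S' (n + 1)).card) := by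
  rw [pow_add, ← card_dig, ← card_dig, ← Fintype.card_prod]
  exact coverNum_le_card _ (pair_cov S S' n)

lemma coord_le_dist (x y : EuclideanSpace ℝ (Fin 2)) (i : Fin 2) : |x i - y i| ≤ dist x y := by
  rw [dist_eq_norm]
  simpa using PiLp.norm_apply_le (x - y) i

lemma pair_low (S S' : Set ℕ) (n : ℕ) : 2 ^ ((pos S n).card + (pos S' n).card) ≤
    coverNum (pairSet (dset S) (dset S')) ((1 / 2) ^ (n + 2)) := by
  rw [pow_add, ← card_dig, ← card_dig, ← Fintype.card_prod]
  refine card_le_coverNum (fun T : Dig S n × Dig S' n =>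
    (!₂[bval T.1.1, bval T.2.1] : EuclideanSpace ℝ (Fin 2)))
    (fun T => ⟨by simpa using dig_mem T.1, by simpa using dig_mem T.2⟩) ?_
    (pair_fin S S' _ (by positivity))
  rintro ⟨T, U⟩ ⟨T', U'⟩ hne
  refine (two_mul_lt n).trans_le ?_
  by_cases h : T = T'
  · have hU : U ≠ U' := fun h' => hne (by rw [h, h'])
    refine le_trans ?_ (coord_le_dist _ _ 1)
    simpa using bval_sep n _ _ (dig_lt U) (dig_lt U') fun h => hU (Subtype.ext h)
  · refine le_trans ?_ (coord_le_dist _ _ 0)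
    simpa using bval_sep n _ _ (dig_lt T) (dig_lt T') fun h' => h (Subtype.ext h')

lemma pos_add (S : Set ℕ) (n : ℕ) : (pos S n).card + (pos Sᶜ n).card = n := by
  classical
  have := Finset.card_filter_add_card_filter_not (s := Finset.range n) (· ∈ S)
  rw [Finset.card_range] at this
  convert this using 3
  all_goals (ext i; simp [pos])

lemma log_top : Tendsto (fun ε : ℝ => Real.log (1 / ε)) (nhdsWithin 0 (Set.Ioi 0)) atTop := by
  simp only [one_div]
  exact Real.tendsto_log_atTop.comp tendsto_inv_nhdsGT_zero

lemma ratio_up (N : ℝ → ℕ) (anti : ∀ ε ε', 0 < ε → ε ≤ ε' → N ε' ≤ N ε)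
    (hpos : ∀ ε, 0 < ε → 1 ≤ N ε)
    (up : ∀ m : ℕ, N ((1 / 2) ^ m) ≤ 2 ^ (m + 1)) (δ : ℝ) (hδ : 0 < δ) :
    ∀ᶠ ε in nhdsWithin (0 : ℝ) (Set.Ioi 0), Real.log (N ε) / Real.log (1 / ε) ≤ 1 + δ := by
  have l2 : 0 < Real.log 2 := Real.log_pos (by norm_num)
  filter_upwards [self_mem_nhdsWithin, log_top.eventually_ge_atTop (2 * Real.log 2 / δ),
    log_top.eventually_gt_atTop 0] with ε hε h1 h2
  have hε : 0 < ε := hε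
  set n := ⌈Real.log (1 / ε) / Real.log 2⌉₊ with hn
  have a1 : Real.log (1 / ε) / Real.log 2 ≤ n := Nat.le_ceil _
  have a2 : (n : ℝ) < Real.log (1 / ε) / Real.log 2 + 1 := Nat.ceil_lt_add_one (by positivity)
  have a3 : (1 / 2 : ℝ) ^ n ≤ ε := by
    rw [← Real.log_le_log_iff (by positivity) hε, Real.log_pow]
    rw [div_le_iff₀ l2] at a1
    simp only [one_div, Real.log_inv] at a1 ⊢
    linarith
  have a4 : N ε ≤ 2 ^ (n + 1) := (anti _ _ (by positivity) a3).trans (up n)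
  have a5 : Real.log (N ε) ≤ (n + 1) * Real.log 2 := by
    have : Real.log (N ε) ≤ Real.log ((2 : ℝ) ^ (n + 1)) :=
      Real.log_le_log (by exact_mod_cast hpos ε hε) (by exact_mod_cast a4)
    rw [Real.log_pow] at this
    exact_mod_cast this
  rw [div_le_iff₀ h2]
  rw [div_le_iff₀ hδ] at h1
  have a6 : (n : ℝ) * Real.log 2 < Real.log (1 / ε) + Real.log 2 := by
    have := mul_lt_mul_of_pos_right a2 l2
    rwa [add_mul, div_mul_cancel₀ _ l2.ne', one_mul] at this
  linarith

lemma ratio_low (N : ℝ → ℕ) (anti : ∀ ε ε', 0 < ε → ε ≤ ε' → N ε' ≤ N ε)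
    (low : ∀ m : ℕ, 2 ^ m ≤ N ((1 / 2) ^ (m + 2))) (δ : ℝ) (hδ : 0 < δ) :
    ∀ᶠ ε in nhdsWithin (0 : ℝ) (Set.Ioi 0), 1 - δ ≤ Real.log (N ε) / Real.log (1 / ε) := by
  have l2 : 0 < Real.log 2 := Real.log_pos (by norm_num)
  filter_upwards [self_mem_nhdsWithin, log_top.eventually_ge_atTop (3 * Real.log 2 / δ),
    log_top.eventually_gt_atTop 0, log_top.eventually_ge_atTop (2 * Real.log 2)] with ε hε h1 h2 h3
  have hε : 0 < ε := hε
  obtain ⟨n, hn⟩ : ∃ n, ⌊Real.log (1 / ε) / Real.log 2⌋₊ = n + 2 := by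
    have : 2 ≤ ⌊Real.log (1 / ε) / Real.log 2⌋₊ := by
      rw [Nat.le_floor_iff (by positivity), le_div_iff₀ l2]
      exact_mod_cast h3
    exact ⟨_, (Nat.sub_add_cancel this).symm⟩
  have a1 : ((n + 2 : ℕ) : ℝ) ≤ Real.log (1 / ε) / Real.log 2 := by
    rw [← hn]; exact Nat.floor_le (by positivity)
  have a2 : Real.log (1 / ε) / Real.log 2 < ((n + 2 : ℕ) : ℝ) + 1 := by
    rw [← hn]; exact Nat.lt_floor_add_one _
  have a3 : ε ≤ (1 / 2 : ℝ) ^ (n + 2) := by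
    rw [← Real.log_le_log_iff hε (by positivity), Real.log_pow]
    rw [le_div_iff₀ l2] at a1
    simp only [one_div, Real.log_inv] at a1 ⊢
    linarith
  have a4 : 2 ^ n ≤ N ε := (low n).trans (anti _ _ hε a3)
  have a5 : n * Real.log 2 ≤ Real.log (N ε) := by
    have : Real.log ((2 : ℝ) ^ n) ≤ Real.log (N ε) :=
      Real.log_le_log (by positivity) (by exact_mod_cast a4)
    rwa [Real.log_pow] at this
  rw [le_div_iff₀ h2]
  rw [div_le_iff₀ hδ] at h1
  rw [div_lt_iff₀ l2] at a2
  push_cast at a2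
  linarith

lemma scale_tendsto (f : ℕ → ℕ) (hf : ∀ k, k ≤ f k) :
    Tendsto (fun k => (1 / 2 : ℝ) ^ (f k)) atTop (nhdsWithin 0 (Set.Ioi 0)) := by
  refine tendsto_nhdsWithin_iff.2 ⟨?_, Eventually.of_forall fun k => by
    simp only [Set.mem_Ioi]; positivity⟩
  exact (tendsto_pow_atTop_nhds_zero_of_lt_one (by norm_num) (by norm_num)).comp
    (tendsto_atTop_mono hf tendsto_id)

lemma log_scale (m : ℕ) : Real.log (1 / (1 / 2 : ℝ) ^ m) = m * Real.log 2 := by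
  simp [Real.log_pow]

lemma lims (N : ℝ → ℕ) (anti : ∀ ε ε', 0 < ε → ε ≤ ε' → N ε' ≤ N ε)
    (hpos : ∀ ε, 0 < ε → 1 ≤ N ε) (s t : ℕ → ℕ) (hst : ∀ m, s m + t m = m)
    (up : ∀ m : ℕ, N ((1 / 2) ^ m) ≤ 2 ^ (s m))
    (low : ∀ m : ℕ, 2 ^ (s m) ≤ N ((1 / 2) ^ (m + 2)))
    (hs : ∀ k, ∃ m, k ≤ m ∧ k * s m ≤ m) (ht : ∀ k, ∃ m, k ≤ m ∧ k * t m ≤ m) :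
    Filter.liminf (fun ε : ℝ => Real.log (N ε) / Real.log (1 / ε))
        (nhdsWithin 0 (Set.Ioi 0)) = 0 ∧
    Filter.limsup (fun ε : ℝ => Real.log (N ε) / Real.log (1 / ε))
        (nhdsWithin 0 (Set.Ioi 0)) = 1 := by
  have l2 : 0 < Real.log 2 := Real.log_pos (by norm_num)
  have U := ratio_up N anti hpos (fun m => (up m).trans
    (Nat.pow_le_pow_right (by norm_num) (by have := hst m; omega)))
  have L : ∀ᶠ ε in nhdsWithin (0 : ℝ) (Set.Ioi 0), 0 ≤ Real.log (N ε) / Real.log (1 / ε) := by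
    filter_upwards [log_top.eventually_gt_atTop 0] with ε h
    exact div_nonneg (Real.log_natCast_nonneg _) h.le
  choose f hf1 hf2 using hs
  choose g hg1 hg2 using ht
  have F : ∀ δ : ℝ, 0 < δ → ∃ᶠ ε in nhdsWithin (0 : ℝ) (Set.Ioi 0),
      Real.log (N ε) / Real.log (1 / ε) ≤ δ := by
    intro δ hδ
    refine (scale_tendsto f hf1).frequently (Eventually.frequently ?_)
    filter_upwards [eventually_ge_atTop ⌈1 / δ⌉₊, eventually_gt_atTop 0] with k hk hk0
    have b1 : 1 / δ ≤ k := (Nat.le_ceil _).trans (by exact_mod_cast hk)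
    have b0 : (0 : ℝ) < k := by exact_mod_cast hk0
    have b2 : (0 : ℝ) < f k := by exact_mod_cast hk0.trans_le (hf1 k)
    rw [log_scale, div_le_iff₀ (by positivity)]
    have b3 : Real.log (N ((1 / 2) ^ f k)) ≤ s (f k) * Real.log 2 := by
      rw [← Real.log_pow]
      exact Real.log_le_log (by exact_mod_cast hpos _ (by positivity)) (by exact_mod_cast up (f k))
    have b4 : (k : ℝ) * s (f k) ≤ f k := by exact_mod_cast hf2 k
    rw [div_le_iff₀ hδ] at b1
    have b5 : (s (f k) : ℝ) ≤ δ * f k := by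
      have : (0 : ℝ) ≤ s (f k) := by positivity
      nlinarith
    nlinarith
  have G : ∀ δ : ℝ, 0 < δ → ∃ᶠ ε in nhdsWithin (0 : ℝ) (Set.Ioi 0),
      1 - δ ≤ Real.log (N ε) / Real.log (1 / ε) := by
    intro δ hδ
    refine (scale_tendsto (fun k => g k + 2) (fun k => (hg1 k).trans (by omega))).frequently
      (Eventually.frequently ?_)
    filter_upwards [eventually_ge_atTop ⌈3 / δ⌉₊, eventually_gt_atTop 0] with k hk hk0
    have b1 : 3 / δ ≤ k := (Nat.le_ceil _).trans (by exact_mod_cast hk)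
    have b0 : (0 : ℝ) < k := by exact_mod_cast hk0
    have b2 : (k : ℝ) ≤ g k := by exact_mod_cast hg1 k
    rw [log_scale, le_div_iff₀ (by positivity)]
    have b3 : s (g k) * Real.log 2 ≤ Real.log (N ((1 / 2) ^ (g k + 2))) := by
      rw [← Real.log_pow]
      exact Real.log_le_log (by positivity) (by exact_mod_cast low (g k))
    have b4 : (k : ℝ) * t (g k) ≤ g k := by exact_mod_cast hg2 k
    have b6 : (s (g k) : ℝ) + t (g k) = g k := by exact_mod_cast hst (g k)
    rw [div_le_iff₀ hδ] at b1
    have b5 : (1 - δ) * (g k + 2) ≤ (s (g k) : ℝ) := by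
      have c1 : (k : ℝ) * (t (g k) + 2) ≤ k * (δ * (g k + 2)) := by nlinarith
      have c2 := le_of_mul_le_mul_left c1 b0
      linarith
    push_cast
    nlinarith
  have bdd1 : IsBoundedUnder (· ≤ ·) (nhdsWithin (0 : ℝ) (Set.Ioi 0))
      (fun ε : ℝ => Real.log (N ε) / Real.log (1 / ε)) := ⟨_, eventually_map.2 (U 1 one_pos)⟩
  have bdd2 : IsBoundedUnder (· ≥ ·) (nhdsWithin (0 : ℝ) (Set.Ioi 0))
      (fun ε : ℝ => Real.log (N ε) / Real.log (1 / ε)) := ⟨0, eventually_map.2 L⟩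
  refine ⟨le_antisymm ?_ ?_, le_antisymm ?_ ?_⟩
  · refine le_of_forall_pos_le_add fun δ hδ => ?_
    rw [zero_add]
    exact liminf_le_of_frequently_le (F δ hδ) bdd2
  · exact le_liminf_of_le bdd1.isCoboundedUnder_ge L
  · refine le_of_forall_pos_le_add fun δ hδ => ?_
    exact limsup_le_of_le bdd2.isCoboundedUnder_le (U δ hδ)
  · refine le_of_forall_pos_le_add fun δ hδ => ?_
    have := le_limsup_of_frequently_le (G δ hδ) bdd1
    linarith

/-- The positions of free digits. -/
def SS : Set ℕ := {i | ∃ j : ℕ, (2 * j).factorial ≤ i ∧ i < (2 * j + 1).factorial}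

lemma SS_sparse (k : ℕ) : ∃ m, k ≤ m ∧ k * (pos SS m).card ≤ m := by
  refine ⟨(2 * k + 2).factorial, (by omega : k ≤ 2 * k + 2).trans (Nat.self_le_factorial _), ?_⟩
  have h : pos SS (2 * k + 2).factorial ⊆ Finset.range (2 * k + 1).factorial := by
    intro i hi
    simp only [pos, Finset.mem_filter, Finset.mem_range] at hi ⊢
    obtain ⟨h1, j, h2, h3⟩ := hi
    have h4 : 2 * j < 2 * k + 2 := by
      by_contra h
      exact absurd (Nat.factorial_le (not_lt.1 h)) (by omega)
    exact h3.trans_le (Nat.factorial_le (by omega))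
  have h1 := Finset.card_le_card h
  rw [Finset.card_range] at h1
  rw [Nat.factorial_succ (2 * k + 1)]
  exact Nat.mul_le_mul (by omega) h1

lemma SS_dense (k : ℕ) : ∃ m, k ≤ m ∧ k * (pos SSᶜ m).card ≤ m := by
  refine ⟨(2 * k + 1).factorial, (by omega : k ≤ 2 * k + 1).trans (Nat.self_le_factorial _), ?_⟩
  have h : pos SSᶜ (2 * k + 1).factorial ⊆ Finset.range (2 * k).factorial := by
    intro i hi
    simp only [pos, Finset.mem_filter, Finset.mem_range] at hi ⊢
    by_contra h
    exact hi.2 ⟨k, not_lt.1 h, hi.1⟩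
  have h1 := Finset.card_le_card h
  rw [Finset.card_range] at h1
  rw [Nat.factorial_succ (2 * k)]
  exact Nat.mul_le_mul (by omega) h1

lemma coverNum_pos {X : Type*} [MetricSpace X] {A : Set X} {ε : ℝ} {x : X} (hx : x ∈ A)
    (h : FinCov A ε) : 1 ≤ coverNum A ε := by
  simpa using card_le_coverNum (fun _ : Unit => x) (fun _ => hx)
    (fun i j hij => absurd (Subsingleton.elim i j) hij) h

lemma dset_lims (S : Set ℕ) (hs : ∀ k, ∃ m, k ≤ m ∧ k * (pos S m).card ≤ m)
    (ht : ∀ k, ∃ m, k ≤ m ∧ k * (pos Sᶜ m).card ≤ m) :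
    Filter.liminf (fun ε : ℝ => Real.log (coverNum (dset S) ε) / Real.log (1 / ε))
        (nhdsWithin 0 (Set.Ioi 0)) = 0 ∧
    Filter.limsup (fun ε : ℝ => Real.log (coverNum (dset S) ε) / Real.log (1 / ε))
        (nhdsWithin 0 (Set.Ioi 0)) = 1 :=
  lims (coverNum (dset S)) (fun ε _ h => coverNum_anti (dset_fin S ε h))
    (fun ε h => coverNum_pos (zero_mem_dset S) (dset_fin S ε h)) _ _ (pos_add S)
    (dset_up S) (dset_low S) hs ht

/-- There exist nonempty `A, B ⊆ [0,1]` whose dimension functions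
`log N(ε)/log(1/ε)` have liminf `0` and limsup `1` as `ε → 0⁺` (so their
Minkowski dimensions do not exist and their upper Minkowski dimensions are `1`),
while the Minkowski dimension of `A × B` exists and equals `1`.  Hence the upper
Minkowski dimension is not product-summable. -/
theorem upper_minkowski_not_product_summable :
    ∃ A B : Set ℝ, A.Nonempty ∧ B.Nonempty ∧ A ⊆ Set.Icc 0 1 ∧ B ⊆ Set.Icc 0 1 ∧
      Filter.liminf (fun ε : ℝ => Real.log (coverNum A ε) / Real.log (1 / ε))
        (nhdsWithin 0 (Set.Ioi 0)) = 0 ∧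
      Filter.limsup (fun ε : ℝ => Real.log (coverNum A ε) / Real.log (1 / ε))
        (nhdsWithin 0 (Set.Ioi 0)) = 1 ∧
      Filter.liminf (fun ε : ℝ => Real.log (coverNum B ε) / Real.log (1 / ε))
        (nhdsWithin 0 (Set.Ioi 0)) = 0 ∧
      Filter.limsup (fun ε : ℝ => Real.log (coverNum B ε) / Real.log (1 / ε))
        (nhdsWithin 0 (Set.Ioi 0)) = 1 ∧
      Filter.Tendsto (fun ε : ℝ => Real.log (coverNum (pairSet A B) ε) / Real.log (1 / ε))
        (nhdsWithin 0 (Set.Ioi 0)) (nhds 1) := by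
  obtain ⟨a1, a2⟩ := dset_lims SS SS_sparse SS_dense
  obtain ⟨b1, b2⟩ := dset_lims SSᶜ SS_dense (by rw [compl_compl]; exact SS_sparse)
  refine ⟨dset SS, dset SSᶜ, ⟨0, zero_mem_dset _⟩, ⟨0, zero_mem_dset _⟩, dset_sub _, dset_sub _,
    a1, a2, b1, b2, ?_⟩
  have anti : ∀ ε ε' : ℝ, 0 < ε → ε ≤ ε' → coverNum (pairSet (dset SS) (dset SSᶜ)) ε' ≤
      coverNum (pairSet (dset SS) (dset SSᶜ)) ε := fun ε _ h => coverNum_anti (pair_fin _ _ ε h)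
  have hpos : ∀ ε : ℝ, 0 < ε → 1 ≤ coverNum (pairSet (dset SS) (dset SSᶜ)) ε := fun ε h =>
    coverNum_pos (x := 0) ⟨by simpa using zero_mem_dset SS, by simpa using zero_mem_dset SSᶜ⟩
      (pair_fin _ _ ε h)
  have up := ratio_up _ anti hpos (fun m => by
    have := pair_up SS SSᶜ m
    rwa [pos_add] at this)
  have low := ratio_low _ anti (fun m => by
    have := pair_low SS SSᶜ m
    rwa [pos_add] at this)
  rw [Metric.tendsto_nhds]
  intro δ hδ
  filter_upwards [up (δ / 2) (by positivity), low (δ / 2) (by positivity)] with ε h1 h2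
  rw [Real.dist_eq, abs_lt]
  constructor <;> linarith
end
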